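/- arXiv:1205.0907 — 2 statements merged into one kernel-verified Lean document; each statement's English description precedes it below -/
import Mathlib

section
/- Suppose A' > 0. Let u = u(y,s) be a classical solution of ∂_s u + ∂_y f(u) = ∂_y² A(u) and let (u_j) = (u_j(t)) solve the semi-discrete scheme u_j'(t) + D_−F(u_j,u_{j+1}) = D_−D_+A(u_j) with monotone split flux F = F₁ + F₂. Then for every ε > 0: ∂_t ψ_ε(u_j,u) + ∂_s ψ_ε(u,u_j) + ∂_y q_ε(u,u_j) + D_− Q^u(u_j,u_{j+1}) − (∂_y² + ∂_y(D_− + D_+) + D_−D_+) |A(u_j) − A(u)|_ε ≤ − E_j^ε, where E_j^ε = (1/Δx²) ∫_{u_{j+1}}^{u_j} ψ_ε''(z,u)(A(z) − A(u_{j+1})) dz + (1/Δx²) ∫_{u_{j−1}}^{u_j} ψ_ε''(z,u)(A(z) − A(u_{j−1})) dz − (1/Δx) ∫_{u_{j−1}}^{u_j} ψ_ε''(z,u) dz · ∂_y A(u) − (1/Δx) ∫_{u_j}^{u_{j+1}} ψ_ε''(z,u) dz · ∂_y A(u) + ∂_y(sign_ε(A(u) − A(u_j))) · ∂_y A(u),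 and Q^c(u,v) = ∫_c^u ψ_ε'(z,c) F₁'(z) dz + ∫_c^v ψ_ε'(z,c) F₂'(z) dz. -/
open MeasureTheory

/-- The Lipschitz approximation of the sign function. -/
noncomputable def signe (ε σ : ℝ) : ℝ :=
  if |σ| < ε then Real.sin (Real.pi * σ / (2 * ε)) else Real.sign σ

/-- `|u|_ε = ∫₀ᵘ sign_ε(z) dz`. -/
noncomputable def abse (ε u : ℝ) : ℝ := ∫ z in (0:ℝ)..u, signe ε z

/-- The entropy `ψ_ε(u,c) = ∫_c^u sign_ε(A(z) − A(c)) dz`. -/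
noncomputable def psie (A : ℝ → ℝ) (ε u c : ℝ) : ℝ :=
  ∫ z in c..u, signe ε (A z - A c)

/-- The entropy flux `q_ε(u,c) = ∫_c^u sign_ε(A(z) − A(c)) f'(z) dz`. -/
noncomputable def qe (A f : ℝ → ℝ) (ε u c : ℝ) : ℝ :=
  ∫ z in c..u, signe ε (A z - A c) * deriv f z

/-- `ψ_ε''(z,c) = sign_ε'(A(z) − A(c)) A'(z)`. -/
noncomputable def psie'' (A : ℝ → ℝ) (ε z c : ℝ) : ℝ :=
  deriv (signe ε) (A z - A c) * deriv A z

/-- The numerical entropy flux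
`Q^c(a,b) = ∫_c^a ψ_ε'(z,c) F₁'(z) dz + ∫_c^b ψ_ε'(z,c) F₂'(z) dz`. -/
noncomputable def QQ (A F₁ F₂ : ℝ → ℝ) (ε c a b : ℝ) : ℝ :=
  (∫ z in c..a, signe ε (A z - A c) * deriv F₁ z)
    + (∫ z in c..b, signe ε (A z - A c) * deriv F₂ z)

/-- Truncation of `σ` to `[-ε, ε]`. -/
noncomputable def clampAt (ε σ : ℝ) : ℝ := max (-ε) (min ε σ)

/-- The derivative of `signe ε`, in manifestly continuous form. -/
noncomputable def signeDeriv (ε σ : ℝ) : ℝ :=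
  Real.cos (Real.pi * clampAt ε σ / (2 * ε)) * (Real.pi / (2 * ε))

lemma continuous_signeDeriv (ε : ℝ) : Continuous (signeDeriv ε) := by
  unfold signeDeriv clampAt
  fun_prop

lemma clampAt_of_mem {ε σ : ℝ} (h₁ : -ε ≤ σ) (h₂ : σ ≤ ε) : clampAt ε σ = σ := by
  rw [clampAt, min_eq_right h₂, max_eq_right h₁]

lemma clampAt_of_ge {ε σ : ℝ} (hε : 0 < ε) (h : ε ≤ σ) : clampAt ε σ = ε := by
  rw [clampAt, min_eq_left h, max_eq_right (by linarith)]

lemma clampAt_of_le {ε σ : ℝ} (hε : 0 < ε) (h : σ ≤ -ε) : clampAt ε σ = -ε := by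
  rw [clampAt, min_eq_right (by linarith), max_eq_left h]

lemma pi_mul_div_two_mul {ε : ℝ} (hε : 0 < ε) : Real.pi * ε / (2 * ε) = Real.pi / 2 := by
  field_simp

lemma pi_mul_neg_div_two_mul {ε : ℝ} (hε : 0 < ε) :
    Real.pi * (-ε) / (2 * ε) = -(Real.pi / 2) := by
  field_simp

lemma signeDeriv_nonneg {ε : ℝ} (hε : 0 < ε) (σ : ℝ) : 0 ≤ signeDeriv ε σ := by
  have h₁ : -ε ≤ clampAt ε σ := le_max_left _ _
  have h₂ : clampAt ε σ ≤ ε := max_le (by linarith) (min_le_left _ _)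
  refine mul_nonneg (Real.cos_nonneg_of_neg_pi_div_two_le_of_le ?_ ?_) (by positivity)
  · rw [← pi_mul_neg_div_two_mul hε]
    gcongr
  · rw [← pi_mul_div_two_mul hε]
    gcongr

lemma signe_of_ge {ε σ : ℝ} (hε : 0 < ε) (h : ε ≤ σ) : signe ε σ = 1 := by
  rw [signe, if_neg (by rw [abs_of_nonneg (by linarith)]; linarith),
    Real.sign_of_pos (by linarith)]

lemma signe_of_le {ε σ : ℝ} (hε : 0 < ε) (h : σ ≤ -ε) : signe ε σ = -1 := by
  rw [signe, if_neg (by rw [abs_of_nonpos (by linarith)]; linarith),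
    Real.sign_of_neg (by linarith)]

lemma signe_of_mem {ε σ : ℝ} (hε : 0 < ε) (h₁ : -ε ≤ σ) (h₂ : σ ≤ ε) :
    signe ε σ = Real.sin (Real.pi * σ / (2 * ε)) := by
  rcases h₁.eq_or_lt with rfl | h₁
  · rw [signe_of_le hε le_rfl, pi_mul_neg_div_two_mul hε, Real.sin_neg, Real.sin_pi_div_two]
  rcases h₂.eq_or_lt with rfl | h₂
  · rw [signe_of_ge hε le_rfl, pi_mul_div_two_mul hε, Real.sin_pi_div_two]
  rw [signe, if_pos (abs_lt.2 ⟨h₁, h₂⟩)]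

lemma signe_neg {ε : ℝ} (hε : 0 < ε) (σ : ℝ) : signe ε (-σ) = -signe ε σ := by
  rcases le_total ε σ with h | h
  · rw [signe_of_ge hε h, signe_of_le hε (by linarith)]
  rcases le_total σ (-ε) with h' | h'
  · rw [signe_of_le hε h', signe_of_ge hε (by linarith), neg_neg]
  rw [signe_of_mem hε h' h, signe_of_mem hε (by linarith) (by linarith), ← Real.sin_neg]
  congr 1
  ring

lemma hasDerivAt_sin_pi_mul_div (ε σ : ℝ) :
    HasDerivAt (fun x => Real.sin (Real.pi * x / (2 * ε)))
      (Real.cos (Real.pi * σ / (2 * ε)) * (Real.pi / (2 * ε))) σ := by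
  have h : HasDerivAt (fun x => Real.pi * x / (2 * ε)) (Real.pi / (2 * ε)) σ := by
    simpa using ((hasDerivAt_id σ).const_mul Real.pi).div_const (2 * ε)
  exact h.sin

lemma hasDerivWithinAt_signe_Icc {ε σ : ℝ} (hε : 0 < ε) (h : σ ∈ Set.Icc (-ε) ε) :
    HasDerivWithinAt (signe ε) (signeDeriv ε σ) (Set.Icc (-ε) ε) σ := by
  rw [signeDeriv, clampAt_of_mem h.1 h.2]
  exact (hasDerivAt_sin_pi_mul_div ε σ).hasDerivWithinAt.congr
    (fun x hx => signe_of_mem hε hx.1 hx.2) (signe_of_mem hε h.1 h.2)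

lemma hasDerivWithinAt_signe_Ici {ε σ : ℝ} (hε : 0 < ε) (h : ε ≤ σ) :
    HasDerivWithinAt (signe ε) (signeDeriv ε σ) (Set.Ici ε) σ := by
  rw [signeDeriv, clampAt_of_ge hε h, pi_mul_div_two_mul hε, Real.cos_pi_div_two, zero_mul]
  exact (hasDerivWithinAt_const σ _ (1 : ℝ)).congr
    (fun x hx => signe_of_ge hε hx) (signe_of_ge hε h)

lemma hasDerivWithinAt_signe_Iic {ε σ : ℝ} (hε : 0 < ε) (h : σ ≤ -ε) :
    HasDerivWithinAt (signe ε) (signeDeriv ε σ) (Set.Iic (-ε)) σ := by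
  rw [signeDeriv, clampAt_of_le hε h, pi_mul_neg_div_two_mul hε, Real.cos_neg,
    Real.cos_pi_div_two, zero_mul]
  exact (hasDerivWithinAt_const σ _ (-1 : ℝ)).congr
    (fun x hx => signe_of_le hε hx) (signe_of_le hε h)

lemma hasDerivAt_signe {ε : ℝ} (hε : 0 < ε) (σ : ℝ) :
    HasDerivAt (signe ε) (signeDeriv ε σ) σ := by
  rcases lt_trichotomy σ (-ε) with h | rfl | h
  · exact (hasDerivWithinAt_signe_Iic hε h.le).hasDerivAt (Iic_mem_nhds h)
  · refine ((hasDerivWithinAt_signe_Iic hε le_rfl).union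
      (hasDerivWithinAt_signe_Icc hε ⟨le_rfl, by linarith⟩)).hasDerivAt ?_
    rw [Set.Iic_union_Icc_eq_Iic (by linarith)]
    exact Iic_mem_nhds (by linarith)
  rcases lt_trichotomy σ ε with h' | rfl | h'
  · exact (hasDerivWithinAt_signe_Icc hε ⟨h.le, h'.le⟩).hasDerivAt (Icc_mem_nhds h h')
  · refine ((hasDerivWithinAt_signe_Icc hε ⟨by linarith, le_rfl⟩).union
      (hasDerivWithinAt_signe_Ici hε le_rfl)).hasDerivAt ?_
    rw [Set.Icc_union_Ici_eq_Ici (by linarith)]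
    exact Ici_mem_nhds (by linarith)
  · exact (hasDerivWithinAt_signe_Ici hε h'.le).hasDerivAt (Ici_mem_nhds h')

lemma continuous_signe {ε : ℝ} (hε : 0 < ε) : Continuous (signe ε) :=
  continuous_iff_continuousAt.2 fun σ => (hasDerivAt_signe hε σ).continuousAt

lemma monotone_signe {ε : ℝ} (hε : 0 < ε) : Monotone (signe ε) :=
  monotone_of_deriv_nonneg (fun σ => (hasDerivAt_signe hε σ).differentiableAt) fun σ => by
    rw [(hasDerivAt_signe hε σ).deriv]
    exact signeDeriv_nonneg hε σ

lemma hasDerivAt_abse {ε : ℝ} (hε : 0 < ε) (x : ℝ) : HasDerivAt (abse ε) (signe ε x) x :=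
  (continuous_signe hε).integral_hasStrictDerivAt 0 x |>.hasDerivAt

lemma psie''_eq {A : ℝ → ℝ} {ε : ℝ} (hε : 0 < ε) (z c : ℝ) :
    psie'' A ε z c = signeDeriv ε (A z - A c) * deriv A z := by
  rw [psie'', (hasDerivAt_signe hε _).deriv]

section Integrals

variable {A : ℝ → ℝ} {ε : ℝ}

lemma hasDerivAt_signe_comp (hε : 0 < ε) (hA : ContDiff ℝ 1 A) (c z : ℝ) :
    HasDerivAt (fun z => signe ε (A z - A c)) (psie'' A ε z c) z := by
  rw [psie''_eq hε]
  exact (hasDerivAt_signe hε _).comp z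
    (((hA.differentiable one_ne_zero) z).hasDerivAt.sub_const (A c))

lemma continuous_signe_comp (hε : 0 < ε) (hA : ContDiff ℝ 1 A) (c : ℝ) :
    Continuous fun z => signe ε (A z - A c) :=
  (continuous_signe hε).comp (hA.continuous.sub continuous_const)

lemma continuous_psie'' (hε : 0 < ε) (hA : ContDiff ℝ 1 A) (c : ℝ) :
    Continuous fun z => psie'' A ε z c := by
  simp_rw [psie''_eq hε]
  exact ((continuous_signeDeriv ε).comp (hA.continuous.sub continuous_const)).mul
    (hA.continuous_deriv le_rfl)

lemma integral_psie'' (hε : 0 < ε) (hA : ContDiff ℝ 1 A) (a b c : ℝ) :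
    ∫ z in a..b, psie'' A ε z c = signe ε (A b - A c) - signe ε (A a - A c) :=
  intervalIntegral.integral_eq_sub_of_hasDerivAt
    (fun z _ => hasDerivAt_signe_comp hε hA c z)
    ((continuous_psie'' hε hA c).intervalIntegrable _ _)

/-- Integration by parts for `ψ_ε''` against the increment of `A`. -/
lemma integral_psie''_mul (hε : 0 < ε) (hA : ContDiff ℝ 1 A) (a b c : ℝ) :
    ∫ z in a..b, psie'' A ε z c * (A z - A a)
      = signe ε (A b - A c) * (A b - A a) - (abse ε (A b - A c) - abse ε (A a - A c)) := by
  have key : ∀ z, HasDerivAt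
      (fun z => signe ε (A z - A c) * (A z - A a) - abse ε (A z - A c))
      (psie'' A ε z c * (A z - A a)) z := fun z => by
    have hAz := ((hA.differentiable one_ne_zero) z).hasDerivAt
    have habs : HasDerivAt (fun z => abse ε (A z - A c))
        (signe ε (A z - A c) * deriv A z) z :=
      (hasDerivAt_abse hε _).comp z (hAz.sub_const (A c))
    refine (((hasDerivAt_signe_comp hε hA c z).mul
      (hAz.sub_const (A a))).sub habs).congr_deriv ?_
    ring
  rw [intervalIntegral.integral_eq_sub_of_hasDerivAt (fun z _ => key z)
    (((continuous_psie'' hε hA c).mul (hA.continuous.sub continuous_const)).intervalIntegrable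
      _ _)]
  ring

/-- A monotone weight against a nondecreasing flux: the integral is controlled by the value of the
weight at the upper endpoint. -/
lemma integral_mul_deriv_le {g F : ℝ → ℝ} (hg : Continuous g) (hmono : Monotone g)
    (hF : ContDiff ℝ 1 F) (hF' : ∀ z, 0 ≤ deriv F z) (a b : ℝ) :
    ∫ z in a..b, g z * deriv F z ≤ g b * (F b - F a) := by
  have hcF := hF.continuous_deriv le_rfl
  have hint : ∫ z in a..b, g b * deriv F z = g b * (F b - F a) := by
    rw [intervalIntegral.integral_const_mul, intervalIntegral.integral_deriv_eq_sub
      (fun z _ => (hF.differentiable one_ne_zero) z) (hcF.intervalIntegrable _ _)]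
  rw [← hint]
  rcases le_total a b with h | h
  · exact intervalIntegral.integral_mono_on h ((hg.mul hcF).intervalIntegrable a b)
      ((continuous_const.mul hcF).intervalIntegrable a b)
      fun z hz => mul_le_mul_of_nonneg_right (hmono hz.2) (hF' z)
  · rw [intervalIntegral.integral_symm b a,
      intervalIntegral.integral_symm (f := fun z => g b * deriv F z) b a, neg_le_neg_iff]
    exact intervalIntegral.integral_mono_on h ((continuous_const.mul hcF).intervalIntegrable b a)
      ((hg.mul hcF).intervalIntegrable b a)
      fun z hz => mul_le_mul_of_nonneg_right (hmono hz.1) (hF' z)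

lemma integral_mul_deriv_le_of_antitone {g F : ℝ → ℝ} (hg : Continuous g) (hmono : Monotone g)
    (hF : ContDiff ℝ 1 F) (hF' : ∀ z, deriv F z ≤ 0) (a b : ℝ) :
    ∫ z in a..b, g z * deriv F z ≤ g a * (F b - F a) := by
  have h := integral_mul_deriv_le hg hmono hF.neg
    (fun z => by rw [deriv.fun_neg]; linarith [hF' z]) b a
  simp only [deriv.fun_neg, mul_neg, intervalIntegral.integral_neg] at h
  rw [intervalIntegral.integral_symm a b] at h
  linarith

/-- The entropy flux balance across a cell is dominated by the weighted flux balance. -/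
lemma QQ_sub_QQ_le {F₁ F₂ : ℝ → ℝ} (hε : 0 < ε) (hA : ContDiff ℝ 1 A) (hAm : Monotone A)
    (hF₁ : ContDiff ℝ 1 F₁) (hF₂ : ContDiff ℝ 1 F₂)
    (hF₁' : ∀ z, 0 ≤ deriv F₁ z) (hF₂' : ∀ z, deriv F₂ z ≤ 0) (c a b d : ℝ) :
    QQ A F₁ F₂ ε c b d - QQ A F₁ F₂ ε c a b
      ≤ signe ε (A b - A c) * ((F₁ b + F₂ d) - (F₁ a + F₂ b)) := by
  have hg := continuous_signe_comp hε hA c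
  have hmono : Monotone fun z => signe ε (A z - A c) := fun x y hxy =>
    monotone_signe hε (sub_le_sub_right (hAm hxy) _)
  have h₁ := integral_mul_deriv_le hg hmono hF₁ hF₁' a b
  have h₂ := integral_mul_deriv_le_of_antitone hg hmono hF₂ hF₂' b d
  have i₁ : ∀ x y, IntervalIntegrable (fun z => signe ε (A z - A c) * deriv F₁ z) volume x y :=
    fun x y => (hg.mul (hF₁.continuous_deriv le_rfl)).intervalIntegrable x y
  have i₂ : ∀ x y, IntervalIntegrable (fun z => signe ε (A z - A c) * deriv F₂ z) volume x y :=
    fun x y => (hg.mul (hF₂.continuous_deriv le_rfl)).intervalIntegrable x y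
  have e₁ := intervalIntegral.integral_interval_sub_left (i₁ c b) (i₁ c a)
  have e₂ := intervalIntegral.integral_interval_sub_left (i₂ c d) (i₂ c b)
  unfold QQ
  linarith

lemma hasDerivAt_psie (hε : 0 < ε) (hA : ContDiff ℝ 1 A) (c x : ℝ) :
    HasDerivAt (fun x => psie A ε x c) (signe ε (A x - A c)) x :=
  ((continuous_signe_comp hε hA c).integral_hasStrictDerivAt c x).hasDerivAt

lemma hasDerivAt_qe {f : ℝ → ℝ} (hε : 0 < ε) (hA : ContDiff ℝ 1 A) (hf : ContDiff ℝ 1 f)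
    (c x : ℝ) :
    HasDerivAt (fun x => qe A f ε x c) (signe ε (A x - A c) * deriv f x) x :=
  (((continuous_signe_comp hε hA c).mul (hf.continuous_deriv le_rfl)).integral_hasStrictDerivAt
    c x).hasDerivAt

end Integrals

/-- the doubling-of-variables inequality
(Lemma `lemma:DoubelingLemma`). -/
theorem stmt_10 (Δx : ℝ) (hΔx : 0 < Δx)
    (f A F₁ F₂ : ℝ → ℝ)
    (hf : ContDiff ℝ 1 f) (hA : ContDiff ℝ 1 A) (hA' : ∀ z, 0 < deriv A z)
    (hF₁ : ContDiff ℝ 1 F₁) (hF₂ : ContDiff ℝ 1 F₂)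
    (hF₁' : ∀ z, 0 ≤ deriv F₁ z) (hF₂' : ∀ z, deriv F₂ z ≤ 0)
    (hsum : ∀ z, deriv F₁ z + deriv F₂ z = deriv f z)
    (u : ℝ → ℝ → ℝ)
    (hu : ContDiff ℝ 2 (fun p : ℝ × ℝ => u p.1 p.2))
    (hAu : ∀ s, Differentiable ℝ (fun y => deriv (fun y' => A (u y' s)) y))
    (hPDE : ∀ y s, deriv (fun s' => u y s') s + deriv (fun y' => f (u y' s)) y
        = deriv (fun y' => deriv (fun y'' => A (u y'' s)) y') y)
    (uG : ℝ → ℤ → ℝ)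
    (hODE : ∀ (t : ℝ) (j : ℤ), HasDerivAt (fun t' => uG t' j)
      (-(((F₁ (uG t j) + F₂ (uG t (j+1))) - (F₁ (uG t (j-1)) + F₂ (uG t j))) / Δx)
        + (A (uG t (j+1)) - 2 * A (uG t j) + A (uG t (j-1))) / Δx ^ 2) t)
    (ε : ℝ) (hε : 0 < ε) :
    ∀ (t : ℝ) (j : ℤ) (y s : ℝ),
      deriv (fun t' => psie A ε (uG t' j) (u y s)) t
        + deriv (fun s' => psie A ε (u y s') (uG t j)) s
        + deriv (fun y' => qe A f ε (u y' s) (uG t j)) y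
        + (QQ A F₁ F₂ ε (u y s) (uG t j) (uG t (j+1))
            - QQ A F₁ F₂ ε (u y s) (uG t (j-1)) (uG t j)) / Δx
        - (deriv (fun y' => deriv (fun y'' => abse ε (A (uG t j) - A (u y'' s))) y') y
            + deriv (fun y' => (abse ε (A (uG t (j+1)) - A (u y' s))
                - abse ε (A (uG t (j-1)) - A (u y' s))) / Δx) y
            + (abse ε (A (uG t (j+1)) - A (u y s)) - 2 * abse ε (A (uG t j) - A (u y s))
                + abse ε (A (uG t (j-1)) - A (u y s))) / Δx ^ 2)
      ≤ -((1 / Δx ^ 2) *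
            (∫ z in (uG t (j+1))..(uG t j), psie'' A ε z (u y s) * (A z - A (uG t (j+1))))
          + (1 / Δx ^ 2) *
            (∫ z in (uG t (j-1))..(uG t j), psie'' A ε z (u y s) * (A z - A (uG t (j-1))))
          - (1 / Δx) * (∫ z in (uG t (j-1))..(uG t j), psie'' A ε z (u y s))
              * deriv (fun y' => A (u y' s)) y
          - (1 / Δx) * (∫ z in (uG t j)..(uG t (j+1)), psie'' A ε z (u y s))
              * deriv (fun y' => A (u y' s)) y
          + deriv (fun y' => signe ε (A (u y' s) - A (uG t j))) y
              * deriv (fun y' => A (u y' s)) y) := by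
  intro t j y s
  have hAm : Monotone A :=
    monotone_of_deriv_nonneg (hA.differentiable one_ne_zero) fun z => (hA' z).le
  have hud := hu.differentiable two_ne_zero
  have huy : ∀ y', DifferentiableAt ℝ (fun y' => u y' s) y' := fun y' =>
    DifferentiableAt.comp (f := fun y' => (y', s)) y' (hud (y', s))
      (differentiableAt_id.prodMk (differentiableAt_const s))
  have hus : DifferentiableAt ℝ (fun s' => u y s') s :=
    DifferentiableAt.comp (f := fun s' => (y, s')) s (hud (y, s))
      ((differentiableAt_const y).prodMk differentiableAt_id)
  set w : ℝ → ℝ := fun y' => A (u y' s)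
  have hwd : ∀ y', HasDerivAt w (deriv w y') y' := fun y' =>
    (((hA.differentiable one_ne_zero) _).comp y' (huy y')).hasDerivAt
  have hwdd : HasDerivAt (deriv w) (deriv (deriv w) y) y := (hAu s y).hasDerivAt
  have habs : ∀ k y', HasDerivAt (fun y' => abse ε (k - w y'))
      (signe ε (w y' - k) * deriv w y') y' := fun k y' => by
    refine (HasDerivAt.comp (h := fun y' => k - w y') y' (hasDerivAt_abse hε (k - w y'))
      ((hwd y').const_sub k)).congr_deriv ?_
    rw [← neg_sub k, signe_neg hε]
    ring
  have hsgn : ∀ k, HasDerivAt (fun y' => signe ε (w y' - k))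
      (signeDeriv ε (w y - k) * deriv w y) y := fun k =>
    HasDerivAt.comp (h := fun y' => w y' - k) y (hasDerivAt_signe hε (w y - k))
      ((hwd y).sub_const k)
  have ht : deriv (fun t' => psie A ε (uG t' j) (u y s)) t = _ :=
    (HasDerivAt.comp (h := fun t' => uG t' j) t
      (hasDerivAt_psie hε hA (u y s) (uG t j)) (hODE t j)).deriv
  have hs : deriv (fun s' => psie A ε (u y s') (uG t j)) s = _ :=
    (HasDerivAt.comp (h := fun s' => u y s') s
      (hasDerivAt_psie hε hA (uG t j) (u y s)) hus.hasDerivAt).deriv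
  have hq : deriv (fun y' => qe A f ε (u y' s) (uG t j)) y = _ :=
    (HasDerivAt.comp (h := fun y' => u y' s) y
      (hasDerivAt_qe hε hA hf (uG t j) (u y s)) (huy y).hasDerivAt).deriv
  have hfu : deriv (fun y' => f (u y' s)) y = deriv f (u y s) * deriv (fun y' => u y' s) y :=
    (HasDerivAt.comp (h := fun y' => u y' s) y
      ((hf.differentiable one_ne_zero) (u y s)).hasDerivAt (huy y).hasDerivAt).deriv
  have hpde := hPDE y s
  rw [hfu] at hpde
  change _ = deriv (deriv w) y at hpde
  have hyy : deriv (fun y' => deriv (fun y'' => abse ε (A (uG t j) - w y'')) y') y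
      = signeDeriv ε (w y - A (uG t j)) * deriv w y * deriv w y
        + signe ε (w y - A (uG t j)) * deriv (deriv w) y := by
    simp_rw [fun y' => (habs (A (uG t j)) y').deriv]
    exact ((hsgn _).mul hwdd).deriv
  have hy : deriv (fun y' => (abse ε (A (uG t (j+1)) - w y')
      - abse ε (A (uG t (j-1)) - w y')) / Δx) y = _ :=
    (((habs (A (uG t (j+1))) y).sub (habs (A (uG t (j-1))) y)).div_const Δx).deriv
  have hQ := div_le_div_of_nonneg_right (QQ_sub_QQ_le hε hA hAm hF₁ hF₂ hF₁' hF₂' (u y s)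
    (uG t (j-1)) (uG t j) (uG t (j+1))) hΔx.le
  have hodd : ∀ k, signe ε (w y - k) = -signe ε (k - w y) := fun k => by
    rw [← signe_neg hε, neg_sub]
  have hwy : A (u y s) = w y := rfl
  change _ + _ + _ + _ - (deriv (fun y' => deriv (fun y'' => abse ε (A (uG t j) - w y'')) y') y
    + _ + _) ≤ -(_ + _ - _ - _ + deriv (fun y' => signe ε (w y' - A (uG t j))) y * _)
  rw [ht, hs, hq, hyy, hy, (hsgn _).deriv, integral_psie''_mul hε hA, integral_psie''_mul hε hA,
    integral_psie'' hε hA, integral_psie'' hε hA]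
  rw [← hpde]
  simp only [hwy, hodd] at hQ ⊢
  rw [← sub_nonneg] at hQ ⊢
  refine hQ.trans_eq ?_
  ring
end

section
/- Let T > 0, let u_Δx : ℝ × [0,T] → ℝ be measurable with u_Δx(·,t) ∈ L¹(ℝ) for each t, and let u : ℝ × [0,T] → ℝ be such that t ↦ u(·,t) is Lipschitz continuous into L¹(ℝ) with constant L_c and u(·,t) ∈ BV(ℝ) ∩ L¹(ℝ) for each t. Define κ(t) = ∫_ℝ ∫_0^T ∫_ℝ |u_Δx(x,t) − u(y,s)| ω_r(x−y) ρ_{r₀}(t−s) dy ds dx. Then for every t ∈ [r₀, T − r₀]: |κ(t) − ‖u_Δx(·,t) − u(·,t)‖_{L¹(ℝ)}| ≤ |u(·,t)|_{BV(ℝ)} r + L_c r₀. -/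
open MeasureTheory

/-- The scaled mollifier `ω_r(x) = ρ(x/r)/r`. -/
noncomputable def moll (ρ : ℝ → ℝ) (r x : ℝ) : ℝ := ρ (x / r) / r

theorem moll_nonneg {ρ : ℝ → ℝ} (hρ : ∀ x, 0 ≤ ρ x) {r : ℝ} (hr : 0 < r) (x : ℝ) :
    0 ≤ moll ρ r x :=
  div_nonneg (hρ _) hr.le

theorem continuous_moll {ρ : ℝ → ℝ} (hρ : Continuous ρ) (r : ℝ) : Continuous (moll ρ r) := by
  unfold moll; fun_prop

theorem moll_eq_zero {ρ : ℝ → ℝ} (hρ : tsupport ρ ⊆ Set.Icc (-1) 1) {r : ℝ} (hr : 0 < r)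
    {x : ℝ} (hx : r < |x|) : moll ρ r x = 0 := by
  have : x / r ∉ tsupport ρ := fun h => by
    have h2 : |x / r| ≤ 1 := abs_le.mpr (hρ h)
    rw [abs_div, abs_of_pos hr, div_le_one hr] at h2
    linarith
  simp [moll, image_eq_zero_of_notMem_tsupport this]

theorem integral_moll {ρ : ℝ → ℝ} (hρ : ∫ x, ρ x = 1) {r : ℝ} (hr : 0 < r) :
    ∫ x, moll ρ r x = 1 := by
  unfold moll
  rw [integral_div, Measure.integral_comp_div ρ r, hρ, abs_of_pos hr]
  simp [hr.ne']

theorem integrable_moll {ρ : ℝ → ℝ} (hρ : ∫ x, ρ x = 1) {r : ℝ} (hr : 0 < r) :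
    Integrable (moll ρ r) := by
  by_contra h
  have h2 := integral_undef h
  rw [integral_moll hρ hr] at h2
  exact one_ne_zero h2

theorem integral_moll_sub {ρ : ℝ → ℝ} (hρ : ∫ x, ρ x = 1) {r : ℝ} (hr : 0 < r) (x : ℝ) :
    ∫ y, moll ρ r (x - y) = 1 := by
  rw [integral_sub_left_eq_self (moll ρ r) volume x, integral_moll hρ hr]

theorem setIntegral_moll_sub {ρ : ℝ → ℝ} (hρs : tsupport ρ ⊆ Set.Icc (-1) 1)
    (hρ : ∫ x, ρ x = 1) {r T t : ℝ} (hr : 0 < r) (ht : t ∈ Set.Icc r (T - r)) :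
    ∫ s in Set.Ioo 0 T, moll ρ r (t - s) = 1 := by
  rw [← integral_Icc_eq_integral_Ioo, setIntegral_eq_integral_of_forall_compl_eq_zero,
    integral_moll_sub hρ hr]
  intro s hs
  refine moll_eq_zero hρs hr ?_
  by_contra! h
  have := abs_le.mp h
  exact hs ⟨by linarith [ht.1], by linarith [ht.2]⟩

theorem lintegral_moll {ρ : ℝ → ℝ} (hρpos : ∀ x, 0 ≤ ρ x) (hρ : ∫ x, ρ x = 1) {r : ℝ}
    (hr : 0 < r) : ∫⁻ x, ENNReal.ofReal (moll ρ r x) = 1 := by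
  rw [← ofReal_integral_eq_lintegral_ofReal (integrable_moll hρ hr)
    (.of_forall fun x => moll_nonneg hρpos hr x), integral_moll hρ hr, ENNReal.ofReal_one]

theorem lintegral_moll_sub_left {ρ : ℝ → ℝ} (hρpos : ∀ x, 0 ≤ ρ x) (hρ : ∫ x, ρ x = 1) {r : ℝ}
    (hr : 0 < r) (x : ℝ) : ∫⁻ y, ENNReal.ofReal (moll ρ r (x - y)) = 1 := by
  rw [lintegral_sub_left_eq_self (fun y => ENNReal.ofReal (moll ρ r y)) x,
    lintegral_moll hρpos hρ hr]

theorem lintegral_moll_sub_right {ρ : ℝ → ℝ} (hρpos : ∀ x, 0 ≤ ρ x) (hρ : ∫ x, ρ x = 1) {r : ℝ}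
    (hr : 0 < r) (y : ℝ) : ∫⁻ x, ENNReal.ofReal (moll ρ r (x - y)) = 1 := by
  rw [lintegral_sub_right_eq_self (fun y => ENNReal.ofReal (moll ρ r y)) y,
    lintegral_moll hρpos hρ hr]

theorem Monotone.intervalIntegral_add_right_sub_le {v : ℝ → ℝ} (hv : Monotone v) {C : ℝ}
    (hC : ∀ a b, v b - v a ≤ C) {h : ℝ} (hh : 0 ≤ h) (a b : ℝ) :
    ∫ x in a..b, (v (x + h) - v x) ≤ h * C := by
  have hi : ∀ c d, IntervalIntegrable v volume c d := fun c d => hv.intervalIntegrable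
  have hs : ∀ c, Monotone fun x => v (x + c) := fun c x y hxy => hv (by linarith)
  rw [intervalIntegral.integral_sub (hs h).intervalIntegrable (hi _ _),
    intervalIntegral.integral_comp_add_right v h]
  have h1 := intervalIntegral.integral_add_adjacent_intervals (hi a b) (hi b (b + h))
  have h2 := intervalIntegral.integral_add_adjacent_intervals (hi a (a + h)) (hi (a + h) (b + h))
  have h3 : (∫ x in a + h..b + h, v x) - ∫ x in a..b, v x
      = (∫ x in (0:ℝ)..h, v (x + b)) - ∫ x in (0:ℝ)..h, v (x + a) := by
    rw [intervalIntegral.integral_comp_add_right v b, intervalIntegral.integral_comp_add_right v a,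
      zero_add, zero_add, add_comm h b, add_comm h a]
    linarith
  rw [h3, ← intervalIntegral.integral_sub (hs b).intervalIntegrable (hs a).intervalIntegrable]
  calc _ ≤ ∫ _ in (0:ℝ)..h, C :=
        intervalIntegral.integral_mono_on hh
          ((hs b).intervalIntegrable.sub (hs a).intervalIntegrable) (by simp)
          fun x _ => hC _ _
    _ = h * C := by simp

theorem BoundedVariationOn.integral_abs_add_right_sub_le {g : ℝ → ℝ} (hg : Integrable g)
    (hbv : BoundedVariationOn g Set.univ) {h : ℝ} (hh : 0 ≤ h) :
    ∫ x, |g (x + h) - g x| ≤ h * (eVariationOn g Set.univ).toReal := by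
  have hl := hbv.locallyBoundedVariationOn
  set v := variationOnFromTo g Set.univ 0 with hv
  have hmono : Monotone v := fun a b hab =>
    variationOnFromTo.monotoneOn hl (Set.mem_univ 0) (Set.mem_univ a) (Set.mem_univ b) hab
  have hadd : ∀ a b, v b - v a = variationOnFromTo g Set.univ a b := fun a b => by
    have := variationOnFromTo.add hl (Set.mem_univ 0) (Set.mem_univ a) (Set.mem_univ b)
    simp only [hv]; linarith
  have hC : ∀ a b, v b - v a ≤ (eVariationOn g Set.univ).toReal := fun a b => by
    rw [hadd]
    rcases le_total a b with hab | hab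
    · rw [variationOnFromTo.eq_of_le _ _ hab]
      exact ENNReal.toReal_mono hbv (eVariationOn.mono _ Set.inter_subset_left)
    · exact (variationOnFromTo.nonpos_of_ge _ _ hab).trans ENNReal.toReal_nonneg
  have hle : ∀ x, |g (x + h) - g x| ≤ v (x + h) - v x := fun x => by
    rw [hadd, ← Real.dist_eq]
    rw [variationOnFromTo.eq_of_le _ _ (by linarith : x ≤ x + h), dist_edist]
    refine ENNReal.toReal_mono (hl _ _ trivial trivial) (eVariationOn.edist_le _ ?_ ?_)
    · exact ⟨trivial, by simpa using hh⟩
    · exact ⟨trivial, by simpa using hh⟩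
  have hint : Integrable fun x => |g (x + h) - g x| := ((hg.comp_add_right h).sub hg).abs
  refine le_of_tendsto (intervalIntegral_tendsto_integral hint
    Filter.tendsto_neg_atTop_atBot Filter.tendsto_id) ?_
  filter_upwards [Filter.eventually_ge_atTop (0:ℝ)] with R hR
  refine (intervalIntegral.integral_mono_on (by simp; linarith) hint.intervalIntegrable ?_
    fun x _ => hle x).trans (hmono.intervalIntegral_add_right_sub_le hC hh _ _)
  have hs : Monotone fun x => v (x + h) := fun x y hxy => hmono (by linarith)
  exact hs.intervalIntegrable.sub hmono.intervalIntegrable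

theorem BoundedVariationOn.integral_abs_sub_right_sub_le {g : ℝ → ℝ} (hg : Integrable g)
    (hbv : BoundedVariationOn g Set.univ) (z : ℝ) :
    ∫ x, |g (x - z) - g x| ≤ |z| * (eVariationOn g Set.univ).toReal := by
  rcases le_total z 0 with hz | hz
  · simpa [abs_of_nonpos hz, sub_eq_add_neg] using
      hbv.integral_abs_add_right_sub_le hg (neg_nonneg.mpr hz)
  · rw [abs_of_nonneg hz, ← integral_add_right_eq_self _ z]
    simpa [abs_sub_comm] using hbv.integral_abs_add_right_sub_le hg hz

/-- Averaging the translates of a function of bounded variation against a mollifier of width `r`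
moves it by at most `r` times its variation in `L¹`. -/
theorem lintegral_abs_sub_mul_moll_le {ρ : ℝ → ℝ} (hρc : Continuous ρ)
    (hρs : tsupport ρ ⊆ Set.Icc (-1) 1) (hρpos : ∀ x, 0 ≤ ρ x) (hρ : ∫ x, ρ x = 1)
    {r : ℝ} (hr : 0 < r) {g : ℝ → ℝ} (hgm : Measurable g) (hg : Integrable g)
    (hbv : BoundedVariationOn g Set.univ) :
    ∫⁻ x, ∫⁻ y, ENNReal.ofReal |g y - g x| * ENNReal.ofReal (moll ρ r (x - y))
      ≤ ENNReal.ofReal ((eVariationOn g Set.univ).toReal * r) := by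
  have hm := (continuous_moll hρc r).measurable
  calc _ = ∫⁻ x, ∫⁻ z, ENNReal.ofReal |g (x - z) - g x| * ENNReal.ofReal (moll ρ r z) := by
        refine lintegral_congr fun x => ?_
        rw [← lintegral_sub_left_eq_self _ x]
        simp
    _ = ∫⁻ z, ∫⁻ x, ENNReal.ofReal |g (x - z) - g x| * ENNReal.ofReal (moll ρ r z) :=
        lintegral_lintegral_swap (by fun_prop)
    _ ≤ ∫⁻ z, ENNReal.ofReal ((eVariationOn g Set.univ).toReal * r)
          * ENNReal.ofReal (moll ρ r z) := by
        refine lintegral_mono fun z => ?_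
        rw [lintegral_mul_const _ (by fun_prop)]
        rcases lt_or_ge r |z| with hz | hz
        · simp [moll_eq_zero hρs hr hz]
        · gcongr
          have hi : Integrable fun x => |g (x - z) - g x| := ((hg.comp_sub_right z).sub hg).abs
          rw [← ofReal_integral_eq_lintegral_ofReal hi
            (.of_forall fun x => abs_nonneg _)]
          refine ENNReal.ofReal_le_ofReal ((hbv.integral_abs_sub_right_sub_le hg z).trans ?_)
          rw [mul_comm]
          gcongr
    _ = _ := by
        rw [lintegral_const_mul _ (by fun_prop), lintegral_moll hρpos hρ hr, mul_one]

theorem abs_integral_sub_integral_le_of_lintegral_le {α : Type*} [MeasurableSpace α]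
    {μ : Measure α} {F G : α → ℝ} {C : ℝ} (hC : 0 ≤ C) (hF : AEStronglyMeasurable F μ)
    (hG : Integrable G μ)
    (h : ∫⁻ p, ENNReal.ofReal |F p - G p| ∂μ ≤ ENNReal.ofReal C) :
    Integrable F μ ∧ |∫ p, F p ∂μ - ∫ p, G p ∂μ| ≤ C := by
  have hd : Integrable (fun p => F p - G p) μ := by
    refine ⟨hF.sub hG.1, ?_⟩
    rw [hasFiniteIntegral_iff_norm]
    exact h.trans_lt ENNReal.ofReal_lt_top
  have hFi : Integrable F μ := (hd.add hG).congr (.of_forall fun p => sub_add_cancel _ _)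
  refine ⟨hFi, ?_⟩
  rw [← integral_sub hFi hG]
  refine abs_integral_le_integral_abs.trans ?_
  rw [integral_eq_lintegral_of_nonneg_ae (.of_forall fun p => abs_nonneg _) hd.abs.1]
  exact ENNReal.toReal_le_of_le_ofReal hC h

/-- the `κ`-lemma (Lemma `lem:kappa`): comparison of the doubled
quantity `κ(t)` with the `L¹` distance `‖u_Δx(·,t) − u(·,t)‖_{L¹}`. -/
theorem stmt_17 (T Lc r r₀ : ℝ) (hT : 0 < T) (hr : 0 < r) (hr₀ : 0 < r₀)
    (ρ : ℝ → ℝ) (hρs : ContDiff ℝ (⊤ : ℕ∞) ρ) (hρsupp : tsupport ρ ⊆ Set.Icc (-1) 1)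
    (hρeven : ∀ x, ρ (-x) = ρ x) (hρpos : ∀ x, 0 ≤ ρ x) (hρint : ∫ x, ρ x = 1)
    (uDx uE : ℝ → ℝ → ℝ)
    (hDxmeas : Measurable fun p : ℝ × ℝ => uDx p.1 p.2)
    (hEmeas : Measurable fun p : ℝ × ℝ => uE p.1 p.2)
    (hDxL1 : ∀ t ∈ Set.Icc (0:ℝ) T, Integrable fun x => uDx x t)
    (hEL1 : ∀ t ∈ Set.Icc (0:ℝ) T, Integrable fun y => uE y t)
    (hEBV : ∀ t ∈ Set.Icc (0:ℝ) T, BoundedVariationOn (fun y => uE y t) Set.univ)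
    (hELip : ∀ t₁ ∈ Set.Icc (0:ℝ) T, ∀ t₂ ∈ Set.Icc (0:ℝ) T,
      (∫ x, |uE x t₁ - uE x t₂|) ≤ Lc * |t₁ - t₂|) :
    ∀ t ∈ Set.Icc r₀ (T - r₀),
      |(∫ x : ℝ, ∫ s in Set.Ioo (0:ℝ) T, ∫ y : ℝ,
          |uDx x t - uE y s| * moll ρ r (x - y) * moll ρ r₀ (t - s))
        - (∫ x : ℝ, |uDx x t - uE x t|)|
      ≤ (eVariationOn (fun y => uE y t) Set.univ).toReal * r + Lc * r₀ := by
  intro t ht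
  have hρc := hρs.continuous
  have htT : t ∈ Set.Icc 0 T := ⟨by linarith [ht.1], by linarith [ht.2]⟩
  have hLc : 0 ≤ Lc := by
    have h := (integral_nonneg fun x => abs_nonneg _).trans
      (hELip T ⟨hT.le, le_rfl⟩ 0 ⟨le_rfl, hT.le⟩)
    rw [sub_zero, abs_of_pos hT] at h
    exact nonneg_of_mul_nonneg_left h hT
  set f : ℝ → ℝ := fun x => uDx x t with hf
  set g : ℝ → ℝ := fun x => uE x t with hg
  have hfm : Measurable f := hDxmeas.comp (measurable_id.prodMk measurable_const)
  have hgm : Measurable g := hEmeas.comp (measurable_id.prodMk measurable_const)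
  have hfg : Integrable fun x => |f x - g x| := ((hDxL1 t htT).sub (hEL1 t htT)).abs
  have hm := (continuous_moll hρc r).measurable
  have hm₀ := (continuous_moll hρc r₀).measurable
  have hp := moll_nonneg hρpos hr
  have hp₀ := moll_nonneg hρpos hr₀
  have hEm : Measurable fun p : ℝ × ℝ × ℝ => uE p.2.2 p.2.1 :=
    hEmeas.comp (measurable_snd.snd.prodMk measurable_snd.fst)
  have hEm' : Measurable fun p : ℝ × ℝ => uE p.2 p.1 :=
    hEmeas.comp (measurable_snd.prodMk measurable_fst)
  set ν : Measure ℝ := volume.restrict (Set.Ioo 0 T) with hν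
  set μ : Measure (ℝ × ℝ × ℝ) := volume.prod (ν.prod volume) with hμ
  set F : ℝ × ℝ × ℝ → ℝ := fun p =>
    |f p.1 - uE p.2.2 p.2.1| * moll ρ r (p.1 - p.2.2) * moll ρ r₀ (t - p.2.1) with hF
  set G : ℝ × ℝ × ℝ → ℝ := fun p =>
    |f p.1 - g p.1| * moll ρ r (p.1 - p.2.2) * moll ρ r₀ (t - p.2.1) with hG
  have hFm : Measurable F := by simp only [hF]; fun_prop
  have hGm : Measurable G := by simp only [hG]; fun_prop
  have hJ : ∫⁻ s, ENNReal.ofReal (moll ρ r₀ (t - s)) ∂ν = 1 := by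
    rw [← ofReal_integral_eq_lintegral_ofReal
      ((integrable_moll hρint hr₀).comp_sub_left t).restrict (.of_forall fun s => hp₀ _),
      setIntegral_moll_sub hρsupp hρint hr₀ ht, ENNReal.ofReal_one]
  have hGi : Integrable G μ := by
    refine ⟨hGm.aestronglyMeasurable, ?_⟩
    rw [hasFiniteIntegral_iff_ofReal
      (.of_forall fun p => mul_nonneg (mul_nonneg (abs_nonneg _) (hp _)) (hp₀ _)),
      lintegral_prod _ (by fun_prop)]
    refine lt_of_le_of_lt (lintegral_mono (g := fun x => ENNReal.ofReal |f x - g x|) fun x => ?_) ?_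
    · rw [lintegral_prod _ (by fun_prop)]
      simp_rw [ENNReal.ofReal_mul' (hp₀ _), ENNReal.ofReal_mul' (hp _)]
      simp_rw [lintegral_mul_const' _ _ ENNReal.ofReal_ne_top,
        lintegral_const_mul' _ _ ENNReal.ofReal_ne_top, lintegral_moll_sub_left hρpos hρint hr,
        mul_one, lintegral_const_mul' _ _ ENNReal.ofReal_ne_top, hJ, mul_one]
      exact le_rfl
    · rw [← ofReal_integral_eq_lintegral_ofReal hfg (.of_forall fun x => abs_nonneg _)]
      exact ENNReal.ofReal_lt_top
  have hA : ∫⁻ p, ENNReal.ofReal |uE p.2.2 p.2.1 - g p.2.2|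
      * ENNReal.ofReal (moll ρ r (p.1 - p.2.2)) * ENNReal.ofReal (moll ρ r₀ (t - p.2.1)) ∂μ
      ≤ ENNReal.ofReal (Lc * r₀) := by
    rw [lintegral_prod _ (by fun_prop), lintegral_lintegral_swap (by
      dsimp [Function.uncurry]; fun_prop)]
    simp_rw [lintegral_mul_const' _ _ ENNReal.ofReal_ne_top,
      lintegral_const_mul' _ _ ENNReal.ofReal_ne_top, lintegral_moll_sub_right hρpos hρint hr,
      mul_one]
    rw [lintegral_prod _ (by fun_prop)]
    simp_rw [lintegral_mul_const' _ _ ENNReal.ofReal_ne_top]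
    calc _ ≤ ∫⁻ s, ENNReal.ofReal (Lc * r₀) * ENNReal.ofReal (moll ρ r₀ (t - s)) ∂ν := by
          refine setLIntegral_mono (by fun_prop) fun s hs => ?_
          rcases lt_or_ge r₀ |t - s| with h | h
          · simp [moll_eq_zero hρsupp hr₀ h]
          · have hs' : s ∈ Set.Icc 0 T := Set.Ioo_subset_Icc_self hs
            gcongr
            have hi : Integrable fun y => |uE y s - g y| := ((hEL1 s hs').sub (hEL1 t htT)).abs
            rw [← ofReal_integral_eq_lintegral_ofReal hi
              (.of_forall fun x => abs_nonneg _)]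
            refine ENNReal.ofReal_le_ofReal ((hELip s hs' t htT).trans ?_)
            rw [abs_sub_comm]
            gcongr
      _ = _ := by rw [lintegral_const_mul' _ _ ENNReal.ofReal_ne_top, hJ, mul_one]
  have hB : ∫⁻ p, ENNReal.ofReal |g p.2.2 - g p.1|
      * ENNReal.ofReal (moll ρ r (p.1 - p.2.2)) * ENNReal.ofReal (moll ρ r₀ (t - p.2.1)) ∂μ
      ≤ ENNReal.ofReal ((eVariationOn g Set.univ).toReal * r) := by
    refine le_trans (le_of_eq ?_) (lintegral_abs_sub_mul_moll_le hρc hρsupp hρpos hρint hr hgm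
      (hEL1 t htT) (hEBV t htT))
    rw [lintegral_prod _ (by fun_prop)]
    refine lintegral_congr fun x => ?_
    rw [lintegral_prod _ (by fun_prop)]
    simp_rw [lintegral_mul_const' _ _ ENNReal.ofReal_ne_top]
    rw [lintegral_const_mul _ (by fun_prop), hJ, mul_one]
  have hV : 0 ≤ (eVariationOn g Set.univ).toReal * r := mul_nonneg ENNReal.toReal_nonneg hr.le
  have hL : 0 ≤ Lc * r₀ := mul_nonneg hLc hr₀.le
  have hFG : ∫⁻ p, ENNReal.ofReal |F p - G p| ∂μ
      ≤ ENNReal.ofReal ((eVariationOn g Set.univ).toReal * r + Lc * r₀) := by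
    rw [ENNReal.ofReal_add hV hL]
    refine le_trans ?_ (add_le_add hB hA)
    rw [← lintegral_add_left (by fun_prop)]
    refine lintegral_mono fun p => ?_
    rw [← add_mul, ← add_mul, ← ENNReal.ofReal_add (abs_nonneg _) (abs_nonneg _),
      ← ENNReal.ofReal_mul' (hp _), ← ENNReal.ofReal_mul' (hp₀ _)]
    refine ENNReal.ofReal_le_ofReal ?_
    simp only [hF, hG]
    rw [← sub_mul, ← sub_mul, abs_mul, abs_mul, abs_of_nonneg (hp _), abs_of_nonneg (hp₀ _)]
    refine mul_le_mul_of_nonneg_right (mul_le_mul_of_nonneg_right ?_ (hp _)) (hp₀ _)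
    refine (abs_abs_sub_abs_le_abs_sub _ _).trans ?_
    rw [sub_sub_sub_cancel_left, abs_sub_comm]
    refine (abs_sub_le _ (g p.2.2) _).trans (le_of_eq (add_comm _ _))
  obtain ⟨hFi, hmain⟩ := abs_integral_sub_integral_le_of_lintegral_le (add_nonneg hV hL)
    hFm.aestronglyMeasurable hGi hFG
  have hFint : ∫ p, F p ∂μ = ∫ x : ℝ, ∫ s in Set.Ioo (0:ℝ) T, ∫ y : ℝ,
      |uDx x t - uE y s| * moll ρ r (x - y) * moll ρ r₀ (t - s) := by
    rw [integral_prod _ hFi]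
    refine integral_congr_ae ?_
    filter_upwards [hFi.prod_right_ae] with x hx
    exact integral_prod _ hx
  have hGint : ∫ p, G p ∂μ = ∫ x : ℝ, |uDx x t - uE x t| := by
    rw [integral_prod _ hGi]
    refine integral_congr_ae ?_
    filter_upwards [hGi.prod_right_ae] with x hx
    rw [integral_prod _ hx]
    simp only [hG]
    simp_rw [integral_mul_const, integral_const_mul, integral_moll_sub hρint hr, mul_one]
    rw [setIntegral_moll_sub hρsupp hρint hr₀ ht, mul_one]
  rwa [hFint, hGint] at hmain
end
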